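/- In the setting of the ACG method applied to ψ = g + h with g μ-strongly convex and (L+μ)-smooth, define for j ≥ 1: Γ_j(u) = g(x̃_j) + ⟨∇g(x̃_j), u − x̃_j⟩ + h(u) + ((2L+μ)/2)‖u − x̃_j‖², u_{j+1} = 2L(x̃_j − ỹ_{j+1}), θ_{j+1}(x) = Γ_j(ỹ_{j+1}) − L‖ỹ_{j+1} − x̃_j‖² + ⟨u_{j+1}, x − ỹ_{j+1}⟩ + (μ/2)‖x − ỹ_{j+1}‖², Θ_0 ≡ 0, Θ_{j+1} = (A_j Θ_j + a_j θ_{j+1})/A_{j+1}, x̂_j = argmin_u Θ_j(u), and s_j = (x_0 − x_j)/A_j. If A_j ≥ 3/μ, then (a) ψ(y_j) − Θ_j(x̂_j) ≤ (μ/(μ A_j − 2)) ‖y_j − x_0‖², and (b) ‖s_j‖ ≤ 3‖y_j − x_0‖/(2A_j). -/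

import Mathlib

noncomputable section

open Set
open scoped RealInnerProductSpace BigOperators

/-- `n`-dimensional Euclidean space. -/
abbrev Euc (k : ℕ) : Type := EuclideanSpace ℝ (Fin k)

variable {n m : ℕ}

/-- `f` is `μ`-strongly convex on the set `s` (with `μ = 0` this is convexity on `s`). -/
def SCOn (s : Set (Euc n)) (mu : ℝ) (f : Euc n → ℝ) : Prop :=
  ∀ ⦃x⦄, x ∈ s → ∀ ⦃y⦄, y ∈ s → ∀ ⦃a c : ℝ⦄, 0 ≤ a → 0 ≤ c → a + c = 1 →
    f (a • x + c • y) ≤ a * f x + c * f y - mu / 2 * (a * c) * ‖x - y‖ ^ 2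

/-- The convex subdifferential of `f` at `x` relative to the domain `s`
(`f` is interpreted as `+∞` outside of `s`). -/
def subdiffOn (s : Set (Euc n)) (f : Euc n → ℝ) (x : Euc n) : Set (Euc n) :=
  {v | ∀ y ∈ s, f x + ⟪v, y - x⟫ ≤ f y}

/-- `p = prox_{η h}(x)`, where `h` is interpreted as `+∞` outside of `s`. -/
def IsProxPt (s : Set (Euc n)) (h : Euc n → ℝ) (eta : ℝ) (x p : Euc n) : Prop :=
  p ∈ s ∧ ∀ ⦃y⦄, y ∈ s → eta * h p + ‖p - x‖ ^ 2 / 2 ≤ eta * h y + ‖y - x‖ ^ 2 / 2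

/-- `f` is differentiable with gradient `f'`, and `f'` is `L`-Lipschitz (i.e. `f` is `L`-smooth). -/
def HasLipGrad (f : Euc n → ℝ) (f' : Euc n → Euc n) (L : ℝ) : Prop :=
  (∀ x, HasGradientAt f (f' x) x) ∧ ∀ x y, ‖f' x - f' y‖ ≤ L * ‖x - y‖
/-- One full run of the ACG method (Algorithm 1) on `ψ = g + h` with parameters `L`, `μ`,
started at `x0 ∈ dom h`.  The minimizations defining `ỹ_{j+1}` are taken over `dom h`
(`h` is interpreted as `+∞` outside of `dom h`). -/
def ACGSpec (domh : Set (Euc n)) (g h : Euc n → ℝ) (g' : Euc n → Euc n) (L mu : ℝ)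
    (x0 : Euc n) (x y xt yt : ℕ → Euc n) (a A tau : ℕ → ℝ) : Prop :=
  A 0 = 0 ∧ tau 0 = 1 ∧ x 0 = x0 ∧ y 0 = x0 ∧ x0 ∈ domh ∧
  (∀ j, a j = (tau j + Real.sqrt (tau j ^ 2 + 8 * tau j * A j * L)) / (4 * L)) ∧
  (∀ j, A (j + 1) = A j + a j) ∧
  (∀ j, tau (j + 1) = tau j + mu * a j) ∧
  (∀ j, xt j = (A j / A (j + 1)) • y j + (a j / A (j + 1)) • x j) ∧
  (∀ j, yt (j + 1) ∈ domh) ∧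
  (∀ j, ∀ u ∈ domh,
      g (xt j) + ⟪g' (xt j), yt (j + 1) - xt j⟫ + h (yt (j + 1)) +
          (2 * L + mu) / 2 * ‖yt (j + 1) - xt j‖ ^ 2 ≤
        g (xt j) + ⟪g' (xt j), u - xt j⟫ + h u +
          (2 * L + mu) / 2 * ‖u - xt j‖ ^ 2) ∧
  (∀ j, (y (j + 1) = y j ∨ y (j + 1) = yt (j + 1)) ∧
      g (y (j + 1)) + h (y (j + 1)) ≤ g (y j) + h (y j) ∧
      g (y (j + 1)) + h (y (j + 1)) ≤ g (yt (j + 1)) + h (yt (j + 1))) ∧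
  (∀ j, x (j + 1) = (A (j + 1) * mu + 1)⁻¹ •
      (((2 * L + mu) * a j) • yt (j + 1) -
        (2 * A j * a j * L / A (j + 1)) • y j))

/-- The aggregate lower model `Θ_j` of the ACG run: `Θ_0 ≡ 0` and
`Θ_{j+1} = (A_j Θ_j + a_j θ_{j+1})/A_{j+1}`, where
`θ_{j+1}(w) = Γ_j(ỹ_{j+1}) - L‖ỹ_{j+1} - x̃_j‖² + ⟪2L(x̃_j - ỹ_{j+1}), w - ỹ_{j+1}⟫ + (μ/2)‖w - ỹ_{j+1}‖²`
and `Γ_j(u) = g(x̃_j) + ⟪∇g(x̃_j), u - x̃_j⟫ + h(u) + ((2L+μ)/2)‖u - x̃_j‖²`. -/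
def ThetaSpec (g h : Euc n → ℝ) (g' : Euc n → Euc n) (L mu : ℝ)
    (xt yt : ℕ → Euc n) (a A : ℕ → ℝ) (Th : ℕ → Euc n → ℝ) : Prop :=
  (∀ w, Th 0 w = 0) ∧
  ∀ j w, Th (j + 1) w =
    (A j * Th j w + a j *
      (g (xt j) + ⟪g' (xt j), yt (j + 1) - xt j⟫ + h (yt (j + 1)) +
          (2 * L + mu) / 2 * ‖yt (j + 1) - xt j‖ ^ 2 -
        L * ‖yt (j + 1) - xt j‖ ^ 2 +
        ⟪(2 * L) • (xt j - yt (j + 1)), w - yt (j + 1)⟫ +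
        mu / 2 * ‖w - yt (j + 1)‖ ^ 2)) / A (j + 1)
lemma aux_descent (g : Euc n → ℝ) (g' : Euc n → Euc n) (K : ℝ)
    (hg : HasLipGrad g g' K) (p q : Euc n) :
    g q ≤ g p + ⟪g' p, q - p⟫ + K / 2 * ‖q - p‖ ^ 2 := by
  obtain ⟨hd, hl⟩ := hg
  set d := q - p with hdd
  let φ : ℝ → ℝ := fun t => g (p + t • d) - t * ⟪g' p, d⟫ - K / 2 * t ^ 2 * ‖d‖ ^ 2
  have hφ : ∀ t, HasDerivAt φ (⟪g' (p + t • d), d⟫ - ⟪g' p, d⟫ - K * t * ‖d‖ ^ 2) t := by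
    intro t
    have h1 : HasDerivAt (fun t : ℝ => p + t • d) d t := by
      simpa using ((hasDerivAt_id t).smul_const d).const_add p
    have h2 := (hd (p + t • d)).hasFDerivAt.comp_hasDerivAt t h1
    have h3 : HasDerivAt (fun t : ℝ => t * ⟪g' p, d⟫) ⟪g' p, d⟫ t := by
      simpa using (hasDerivAt_id t).mul_const ⟪g' p, d⟫
    have h4 : HasDerivAt (fun t : ℝ => K / 2 * t ^ 2 * ‖d‖ ^ 2) (K * t * ‖d‖ ^ 2) t := by
      have := (((hasDerivAt_id t).pow 2).const_mul (K / 2)).mul_const (‖d‖ ^ 2)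
      exact this.congr_deriv (by push_cast; simp only [id, Nat.add_one_sub_one, pow_one]; ring)
    have h5 := (h2.sub h3).sub h4
    exact h5.congr_deriv (by simp)
  have hanti : AntitoneOn φ (Icc 0 1) := by
    apply antitoneOn_of_deriv_nonpos (convex_Icc 0 1)
    · exact fun t _ => (hφ t).continuousAt.continuousWithinAt
    · exact fun t _ => (hφ t).differentiableAt.differentiableWithinAt
    · intro t ht
      rw [interior_Icc] at ht
      rw [(hφ t).deriv, ← inner_sub_left]
      have h1 := real_inner_le_norm (g' (p + t • d) - g' p) d
      have h2 := hl (p + t • d) p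
      rw [add_sub_cancel_left, norm_smul, Real.norm_of_nonneg ht.1.le] at h2
      nlinarith [norm_nonneg d, mul_le_mul_of_nonneg_right h2 (norm_nonneg d)]
  have := hanti (left_mem_Icc.2 zero_le_one) (right_mem_Icc.2 zero_le_one) zero_le_one
  simp [φ] at this
  have e : p + d = q := by simp [hdd]
  rw [e] at this
  linarith

lemma aux_le_of_small (u v : ℝ) (h : ∀ t : ℝ, 0 < t → t < 1 → 0 ≤ u + t * v) : 0 ≤ u := by
  by_contra hu
  push Not at hu
  have h1 : 0 < |v| + 1 + -u   := by linarith [abs_nonneg v]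
  have h2 := h (-u / (2 * (|v| + 1 + -u))) (by apply div_pos <;> linarith) (by
    rw [div_lt_one (by linarith)]; linarith [abs_nonneg v])
  have h3 : -u / (2 * (|v| + 1 + -u)) * v ≤ -u / 2 := by
    rw [div_mul_eq_mul_div, div_le_div_iff₀ (by linarith) (by norm_num)]
    nlinarith [le_abs_self v]
  linarith

lemma aux_sc (g : Euc n → ℝ) (v : Euc n) (mu : ℝ) (hg : SCOn Set.univ mu g) (p q : Euc n)
    (hv : HasGradientAt g v p) :
    g p + ⟪v, q - p⟫ + mu / 2 * ‖q - p‖ ^ 2 ≤ g q := by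
  set d := q - p with hdd
  have hconv : ∀ t : ℝ, 0 ≤ t → t ≤ 1 →
      g (p + t • d) ≤ (1 - t) * g p + t * g q - mu / 2 * ((1 - t) * t) * ‖d‖ ^ 2 := by
    intro t h0 h1
    have := hg (mem_univ p) (mem_univ q) (a := 1 - t) (c := t) (by linarith) h0 (by ring)
    rw [norm_sub_rev] at this
    convert this using 2
    rw [hdd]; module
  have h1 : HasDerivAt (fun t : ℝ => p + t • d) d 0 := by
    simpa using ((hasDerivAt_id (0:ℝ)).smul_const d).const_add p
  have hv' : HasGradientAt g v (p + (0:ℝ) • d) := by simpa using hv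
  have h2 := hv'.hasFDerivAt.comp_hasDerivAt (0:ℝ) h1
  let φ : ℝ → ℝ := fun t => (1 - t) * g p + t * g q - mu / 2 * ((1 - t) * t) * ‖d‖ ^ 2
    - g (p + t • d)
  have h3 : HasDerivAt φ (g q - g p - mu / 2 * ‖d‖ ^ 2 - ⟪v, d⟫) 0 := by
    have e1 : HasDerivAt (fun t : ℝ => (1 - t) * g p + t * g q
        - mu / 2 * ((1 - t) * t) * ‖d‖ ^ 2) (g q - g p - mu / 2 * ‖d‖ ^ 2) 0 := by
      have i := hasDerivAt_id (0:ℝ)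
      have j := i.const_sub 1
      have := ((j.mul_const (g p)).add (i.mul_const (g q))).sub
        (((j.mul i).const_mul (mu / 2)).mul_const (‖d‖ ^ 2))
      exact this.congr_deriv (by simp; ring)
    have := e1.sub h2
    exact this.congr_deriv (by simp)
  have h4 := h3.tendsto_slope_zero_right
  have h5 : 0 ≤ g q - g p - mu / 2 * ‖d‖ ^ 2 - ⟪v, d⟫ := by
    apply ge_of_tendsto h4
    filter_upwards [Ioc_mem_nhdsGT (zero_lt_one (α := ℝ))] with t ht
    have e := hconv t ht.1.le ht.2
    have : φ 0 = 0 := by simp [φ]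
    rw [zero_add, this, sub_zero, smul_eq_mul]
    have : 0 ≤ φ t := by simp only [φ]; linarith
    have := ht.1
    positivity
  linarith

lemma aux_prox (domh : Set (Euc n)) (h : Euc n → ℝ) (hh : ConvexOn ℝ domh h) (K : ℝ)
    (v p q w : Euc n) (hq : q ∈ domh) (hw : w ∈ domh)
    (hmin : ∀ u ∈ domh, ⟪v, q - p⟫ + h q + K / 2 * ‖q - p‖ ^ 2
      ≤ ⟪v, u - p⟫ + h u + K / 2 * ‖u - p‖ ^ 2) :
    h q ≤ h w + ⟪v, w - q⟫ + K * ⟪q - p, w - q⟫ := by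
  have := aux_le_of_small (h w - h q + ⟪v, w - q⟫ + K * ⟪q - p, w - q⟫)
    (K / 2 * ‖w - q‖ ^ 2) (by
    intro t h0 h1
    have hu : (1 - t) • q + t • w ∈ domh :=
      hh.1 hq hw (by linarith) h0.le (by ring)
    have hc := hh.2 hq hw (show (0:ℝ) ≤ 1 - t by linarith) h0.le (by ring)
    have hm := hmin _ hu
    have e : (1 - t) • q + t • w - p = (q - p) + t • (w - q) := by module
    rw [e, norm_add_sq_real, inner_add_right, inner_smul_right, inner_smul_right, norm_smul,
      Real.norm_of_nonneg h0.le] at hm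
    simp only [smul_eq_mul] at hc
    have : 0 ≤ t * (h w - h q + ⟪v, w - q⟫ + K * ⟪q - p, w - q⟫ + t * (K / 2 * ‖w - q‖ ^ 2)) := by
      linarith
    exact nonneg_of_mul_nonneg_right this h0)
  linarith

lemma aux_quad (τ b : ℝ) (x p q w v : Euc n)
    (hx : (τ + b) • x = τ • p + b • q - v) :
    τ / 2 * ‖w - p‖ ^ 2 + ⟪v, w - q⟫ + b / 2 * ‖w - q‖ ^ 2 =
    τ / 2 * ‖x - p‖ ^ 2 + ⟪v, x - q⟫ + b / 2 * ‖x - q‖ ^ 2 + (τ + b) / 2 * ‖w - x‖ ^ 2 := by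
  have e : v = τ • (p - x) + b • (q - x) := by
    have : v = τ • p + b • q - (τ + b) • x := by rw [hx]; abel
    rw [this]; module
  set d := w - x
  have e1 : w - p = d + (x - p) := by simp [d]
  have e2 : w - q = d + (x - q) := by simp [d]
  have e3 : ⟪v, d⟫ = -(τ * ⟪d, x - p⟫ + b * ⟪d, x - q⟫) := by
    rw [e, inner_add_left, inner_smul_left, inner_smul_left, real_inner_comm, real_inner_comm d,
      ← neg_sub x p, ← neg_sub x q, inner_neg_right, inner_neg_right]
    simp; ring
  rw [e1, e2, norm_add_sq_real, norm_add_sq_real, inner_add_right, e3]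
  ring

lemma aux_step (L A a τ : ℝ) (hL : 0 < L) (hA : 0 < A + a) (x y xt yt w : Euc n)
    (ha : 2 * L * a ^ 2 = τ * (A + a))
    (hxt : (A + a) • xt = A • y + a • x) :
    (A + a) * (L * ‖yt - xt‖ ^ 2) ≤
      A * ⟪(2 * L) • (xt - yt), y - yt⟫ + a * ⟪(2 * L) • (xt - yt), w - yt⟫
        + τ / 2 * ‖w - x‖ ^ 2 := by
  rw [norm_sub_rev yt]
  set d := xt - yt with hd
  set e := w - x with he
  have h1 : A • (y - yt) + a • (w - yt) = (A + a) • d + a • e := by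
    have : (A + a) • d = A • y + a • x - (A + a) • yt := by rw [hd, smul_sub, hxt]
    rw [this, he]; module
  have h2 : A * ⟪(2 * L) • d, y - yt⟫ + a * ⟪(2 * L) • d, w - yt⟫
      = 2 * L * ((A + a) * ‖d‖ ^ 2 + a * ⟪d, e⟫) := by
    rw [← inner_smul_right, ← inner_smul_right, ← inner_add_right, h1, inner_smul_left,
      inner_add_right, inner_smul_right, inner_smul_right, real_inner_self_eq_norm_sq]
    simp
  rw [h2]
  have h3 : ‖(A + a) • d + a • e‖ ^ 2
      = (A + a) ^ 2 * ‖d‖ ^ 2 + 2 * ((A + a) * a * ⟪d, e⟫) + a ^ 2 * ‖e‖ ^ 2 := by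
    rw [norm_add_sq_real, norm_smul, norm_smul, inner_smul_left, inner_smul_right, mul_pow,
      mul_pow, Real.norm_eq_abs, Real.norm_eq_abs, sq_abs, sq_abs]
    simp; ring
  have h4 : 0 ≤ L * ‖(A + a) • d + a • e‖ ^ 2 := by positivity
  rw [h3] at h4
  have h5 : 0 ≤ (A + a) * (L * (A + a) * ‖d‖ ^ 2 + 2 * L * a * ⟪d, e⟫ + τ / 2 * ‖e‖ ^ 2) := by
    have : (A + a) * (τ / 2 * ‖e‖ ^ 2) = L * a ^ 2 * ‖e‖ ^ 2 := by
      linear_combination (-‖e‖ ^ 2 / 2) * ha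
    nlinarith
  have h6 := nonneg_of_mul_nonneg_right h5 hA
  linarith

lemma aux_min (f : Euc n → ℝ) (c κ m : ℝ) (hc : 0 < c) (hκ : 0 < κ) (p q z w : Euc n)
    (hf : ∀ w, c * f w + 1 / 2 * ‖w - q‖ ^ 2 = m + (1 + κ) / 2 * ‖w - p‖ ^ 2)
    (hz : ∀ u, f z ≤ f u) : c * f z + κ / 2 * ‖w - z‖ ^ 2 = c * f w := by
  have key : ∀ w z' : Euc n, κ • z' = (1 + κ) • p - q →
      c * f w = c * f z' + κ / 2 * ‖w - z'‖ ^ 2 := by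
    intro w z' h
    have := aux_quad (1 + κ) (-1) z' p q w 0 (by
      rw [show 1 + κ + -1 = κ by ring, h]; module)
    simp only [inner_zero_left] at this
    have h1 := hf w
    have h2 := hf z'
    rw [show 1 + κ + -1 = κ by ring] at this
    linarith
  set z0 : Euc n := κ⁻¹ • ((1 + κ) • p - q) with hz0
  have hz0' : κ • z0 = (1 + κ) • p - q := by rw [hz0, smul_inv_smul₀ hκ.ne']
  have h1 := key z z0 hz0'
  have h2 := mul_le_mul_of_nonneg_left (hz z0) hc.le
  have h3 : ‖z - z0‖ ^ 2 = 0 := by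
    have : κ / 2 * ‖z - z0‖ ^ 2 ≤ 0 := by linarith
    have h4 := sq_nonneg ‖z - z0‖
    by_contra hne
    have : 0 < ‖z - z0‖ ^ 2 := lt_of_le_of_ne h4 (Ne.symm hne)
    have : 0 < κ / 2 * ‖z - z0‖ ^ 2 := by positivity
    linarith
  have h4 : z = z0 := by
    rw [sq_eq_zero_iff, norm_eq_zero, sub_eq_zero] at h3
    exact h3
  rw [h4]
  exact (key w z0 hz0').symm

lemma aux_theta (domh : Set (Euc n)) (g h : Euc n → ℝ) (L mu : ℝ)
    (hgsc : SCOn Set.univ mu g) (v xt yt w : Euc n) (hv : HasGradientAt g v xt)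
    (hh : ConvexOn ℝ domh h) (hq : yt ∈ domh) (hw : w ∈ domh)
    (hmin : ∀ u ∈ domh,
      g xt + ⟪v, yt - xt⟫ + h yt + (2 * L + mu) / 2 * ‖yt - xt‖ ^ 2
      ≤ g xt + ⟪v, u - xt⟫ + h u + (2 * L + mu) / 2 * ‖u - xt‖ ^ 2) :
    g xt + ⟪v, yt - xt⟫ + h yt + (2 * L + mu) / 2 * ‖yt - xt‖ ^ 2 - L * ‖yt - xt‖ ^ 2
      + ⟪(2 * L) • (xt - yt), w - yt⟫ + mu / 2 * ‖w - yt‖ ^ 2 ≤ g w + h w := by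
  have h1 := aux_sc g v mu hgsc xt w hv
  have h2 := aux_prox domh h hh (2 * L + mu) v xt yt w hq hw (by
    intro u hu; linarith [hmin u hu])
  have e : w - xt = (w - yt) + (yt - xt) := by abel
  rw [e, norm_add_sq_real, inner_add_right] at h1
  rw [← neg_sub yt xt, inner_smul_left, inner_neg_left]
  simp only [RCLike.conj_to_real]
  have := real_inner_comm (yt - xt) (w - yt)
  rw [this] at h1
  linarith

/-!
STATEMENT 1 (Technical lemma for the ACG method: bounds on `ψ(y_j) - Θ_j(x̂_j)` and on
`s_j = (x_0 - x_j)/A_j` when `A_j ≥ 3/μ`).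
-/

theorem acg_tech
    (domh : Set (Euc n)) (g h : Euc n → ℝ) (g' : Euc n → Euc n)
    (L mu : ℝ) (hL : 0 < L) (hmu : 0 < mu)
    (hgsc : SCOn Set.univ mu g) (hgsmooth : HasLipGrad g g' (L + mu))
    (hhconv : ConvexOn ℝ domh h) (hdomclosed : IsClosed domh)
    (hhlsc : LowerSemicontinuousOn h domh) (hdomne : domh.Nonempty)
    (x y xt yt : ℕ → Euc n) (a A tau : ℕ → ℝ) (x0 : Euc n)
    (hrun : ACGSpec domh g h g' L mu x0 x y xt yt a A tau)
    (Th : ℕ → Euc n → ℝ)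
    (hTh : ThetaSpec g h g' L mu xt yt a A Th)
    -- `x̂_j` is the (global) minimizer of `Θ_j`
    (xhat : ℕ → Euc n)
    (hxhat : ∀ j : ℕ, 1 ≤ j → ∀ u : Euc n, Th j (xhat j) ≤ Th j u) :
    ∀ j : ℕ, 1 ≤ j → A j ≥ 3 / mu →
      -- (a)
      (g (y j) + h (y j) - Th j (xhat j) ≤
        mu / (mu * A j - 2) * ‖y j - x 0‖ ^ 2) ∧
      -- (b)  `s_j = (x_0 - x_j)/A_j`
      ‖(A j)⁻¹ • (x 0 - x j)‖ ≤ 3 * ‖y j - x 0‖ / (2 * A j) := by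
  obtain ⟨hA0, ht0, hx0, hy0, hx0d, ha, hA, htau, hxt, hytd, hmin, hy, hx⟩ := hrun
  obtain ⟨hT0, hT⟩ := hTh
  have inv : ∀ j, y j ∈ domh ∧ 0 ≤ A j ∧ tau j = 1 + mu * A j ∧
      (∀ w ∈ domh, A j * Th j w ≤ A j * (g w + h w)) ∧
      ∃ c, A j * (g (y j) + h (y j)) ≤ c ∧
        ∀ w, A j * Th j w + 1 / 2 * ‖w - x 0‖ ^ 2 = c + tau j / 2 * ‖w - x j‖ ^ 2 := by
    intro j
    induction j with
    | zero =>
      refine ⟨hy0 ▸ hx0d, hA0.ge, by rw [hA0, ht0]; ring, by simp [hA0], 0, by simp [hA0], ?_⟩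
      intro w
      rw [hA0, ht0]; ring
    | succ j ih =>
      obtain ⟨hyd, hAn, hτ, hlow, c, hc, hq⟩ := ih
      have hτp : 0 < tau j := by rw [hτ]; positivity
      have hs0 : 0 ≤ tau j ^ 2 + 8 * tau j * A j * L := by positivity
      have hsq := Real.sq_sqrt hs0
      have hap : 0 < a j := by rw [ha]; positivity
      have hquad : 2 * L * a j ^ 2 = tau j * (A j + a j) := by
        have e : 4 * L * a j - tau j = Real.sqrt (tau j ^ 2 + 8 * tau j * A j * L) := by
          rw [ha]; field_simp; ring
        rw [← e] at hsq
        have : 8 * L * (2 * L * a j ^ 2) = 8 * L * (tau j * (A j + a j)) := by linarith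
        exact mul_left_cancel₀ (by positivity) this
      have hAp : 0 < A j + a j := by linarith
      have hxt' : (A j + a j) • xt j = A j • y j + a j • x j := by
        rw [hxt, hA, smul_add, smul_smul, smul_smul, mul_div_cancel₀ _ hAp.ne',
          mul_div_cancel₀ _ hAp.ne']
      have hτ' : tau (j + 1) = 1 + mu * A (j + 1) := by rw [htau, hA, hτ]; ring
      have hxx : (tau j + a j * mu) • x (j + 1) = tau j • x j + (a j * mu) • yt (j + 1)
          - a j • ((2 * L) • (xt j - yt (j + 1))) := by
        have hne : A (j + 1) * mu + 1 ≠ 0 := by rw [hA]; positivity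
        have e1 : tau j + a j * mu = A (j + 1) * mu + 1 := by rw [hA, hτ]; ring
        have e2 : (a j * (2 * L)) • xt j
            = (2 * A j * a j * L / A (j + 1)) • y j + tau j • x j := by
          rw [hxt, hA, smul_add, smul_smul, smul_smul]
          congr 2
          · ring
          · field_simp; linarith
        rw [e1, hx, smul_inv_smul₀ hne, smul_sub, smul_sub, smul_smul, smul_smul, e2]
        module
      have hyd' : y (j + 1) ∈ domh := by
        rcases (hy j).1 with h | h
        · rw [h]; exact hyd
        · rw [h]; exact hytd j
      refine ⟨hyd', by rw [hA]; exact hAp.le, hτ', ?_, ?_⟩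
      · intro w hw
        have h1 := aux_theta domh g h L mu hgsc (g' (xt j)) (xt j) (yt (j + 1)) w
          (hgsmooth.1 _) hhconv (hytd j) hw (hmin j)
        rw [hT, mul_div_cancel₀ _ (by rw [hA]; exact hAp.ne'), hA]
        linarith [hlow w hw, mul_le_mul_of_nonneg_left h1 hap.le]
      set G := g (xt j) + ⟪g' (xt j), yt (j + 1) - xt j⟫ + h (yt (j + 1)) +
          (2 * L + mu) / 2 * ‖yt (j + 1) - xt j‖ ^ 2 with hG
      have hrec : ∀ w, A (j + 1) * Th (j + 1) w + 1 / 2 * ‖w - x 0‖ ^ 2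
          = c + tau j / 2 * ‖w - x j‖ ^ 2 + a j * (G - L * ‖yt (j + 1) - xt j‖ ^ 2 +
            ⟪(2 * L) • (xt j - yt (j + 1)), w - yt (j + 1)⟫ +
            mu / 2 * ‖w - yt (j + 1)‖ ^ 2) := by
        intro w
        rw [hT, mul_div_cancel₀ _ (by rw [hA]; exact hAp.ne')]
        rw [← hG]
        linarith [hq w]
      refine ⟨c + tau j / 2 * ‖x (j + 1) - x j‖ ^ 2 + a j * (G - L * ‖yt (j + 1) - xt j‖ ^ 2 +
            ⟪(2 * L) • (xt j - yt (j + 1)), x (j + 1) - yt (j + 1)⟫ +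
            mu / 2 * ‖x (j + 1) - yt (j + 1)‖ ^ 2), ?_, ?_⟩
      · have h1 := aux_theta domh g h L mu hgsc (g' (xt j)) (xt j) (yt (j + 1)) (y j)
          (hgsmooth.1 _) hhconv (hytd j) hyd (hmin j)
        rw [← hG] at h1
        have h2 := aux_step L (A j) (a j) (tau j) hL hAp (x j) (y j) (xt j) (yt (j + 1))
          (x (j + 1)) hquad hxt'
        have h3 := aux_descent g g' _ hgsmooth (xt j) (yt (j + 1))
        have h4 : g (y (j + 1)) + h (y (j + 1)) ≤ G := by
          have := mul_nonneg hL.le (sq_nonneg ‖yt (j + 1) - xt j‖)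
          rw [hG]
          linarith [(hy j).2.2]
        have h5 := mul_le_mul_of_nonneg_left h4 hAp.le
        have h6 := mul_le_mul_of_nonneg_left h1 hAn
        have h7 : 0 ≤ A j * (mu / 2 * ‖y j - yt (j + 1)‖ ^ 2) := by positivity
        have h8 : 0 ≤ a j * (mu / 2 * ‖x (j + 1) - yt (j + 1)‖ ^ 2) := by positivity
        rw [hA]
        linarith
      · intro w
        have := aux_quad (tau j) (a j * mu) (x (j + 1)) (x j) (yt (j + 1)) w
          (a j • ((2 * L) • (xt j - yt (j + 1)))) hxx
        rw [inner_smul_left, inner_smul_left (x := (2 * L) • (xt j - yt (j + 1)))] at this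
        simp only [RCLike.conj_to_real] at this
        rw [hrec w, htau]
        linarith
  intro j hj hAj
  obtain ⟨hyd, -, hτ, hlow, c, hc, hq⟩ := inv j
  have hAp : 0 < A j := lt_of_lt_of_le (by positivity) hAj
  have hmA : 3 ≤ mu * A j := by
    have := (div_le_iff₀ hmu).1 hAj
    linarith
  have hTy := hlow _ hyd
  constructor
  · have h1 := aux_min (Th j) (A j) (mu * A j) c hAp (by positivity) (x j) (x 0) (xhat j) (y j)
      (by rw [← hτ]; exact hq) (hxhat j hj)
    have h2 := hq (xhat j)
    have h3 : 0 ≤ tau j / 2 * ‖xhat j - x j‖ ^ 2 := by rw [hτ]; positivity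
    have h4 : 1 / 2 * ‖xhat j - x 0‖ ^ 2 ≤ ‖y j - xhat j‖ ^ 2 + ‖y j - x 0‖ ^ 2 := by
      have e : ‖xhat j - x 0‖ ≤ ‖y j - xhat j‖ + ‖y j - x 0‖ := by
        have := norm_sub_le_norm_sub_add_norm_sub (xhat j) (y j) (x 0)
        rwa [norm_sub_rev (xhat j) (y j)] at this
      have e2 := pow_le_pow_left₀ (norm_nonneg _) e 2
      nlinarith [sq_nonneg (‖y j - xhat j‖ - ‖y j - x 0‖)]
    have h5 : mu / 2 * ‖y j - xhat j‖ ^ 2 ≤ g (y j) + h (y j) - Th j (xhat j) := by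
      have : A j * (mu / 2 * ‖y j - xhat j‖ ^ 2)
          ≤ A j * (g (y j) + h (y j) - Th j (xhat j)) := by linarith
      exact le_of_mul_le_mul_left this hAp
    have h6 : A j * (g (y j) + h (y j) - Th j (xhat j))
        ≤ ‖y j - xhat j‖ ^ 2 + ‖y j - x 0‖ ^ 2 := by linarith
    rw [div_mul_eq_mul_div, le_div_iff₀ (by linarith)]
    linarith [mul_le_mul_of_nonneg_left h6 hmu.le]
  · have h1 := hq (y j)
    have h2 : 4 * ‖y j - x j‖ ^ 2 ≤ ‖y j - x 0‖ ^ 2 := by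
      have : 4 * ‖y j - x j‖ ^ 2 ≤ tau j * ‖y j - x j‖ ^ 2 :=
        mul_le_mul_of_nonneg_right (by linarith) (by positivity)
      linarith
    have h3 : 2 * ‖y j - x j‖ ≤ ‖y j - x 0‖ :=
      by
      nlinarith [norm_nonneg (y j - x j), norm_nonneg (y j - x 0)]
    have h4 := norm_sub_le_norm_sub_add_norm_sub (x 0) (y j) (x j)
    rw [norm_sub_rev (x 0) (y j)] at h4
    rw [norm_smul, norm_inv, Real.norm_of_nonneg hAp.le, inv_mul_eq_div,
      div_le_div_iff₀ hAp (by positivity)]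
    nlinarith
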